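/- Codeword-independent ML union bound. Let n ≥ 1, let G be a finite set of n×n permutation matrices that contains the identity and is closed under matrix multiplication and inversion (a group), let s ∈ ℝⁿ have pairwise distinct entries, let σ > 0, and let X ∈ G. Let z be distributed according to the product measure on ℝⁿ with i.i.d. N(0, σ²) coordinates and set y = X s + z. Then the probability of the event { there exists X̃ ∈ G with X̃ ≠ X and yᵀ(X̃ s) ≥ yᵀ(X s) } is at most Σ_{X̃ ∈ G, X̃ ≠ I} Q( ‖X̃ s − s‖ / (2σ) ); in particular this upper bound on the block error probability of ML decoding does not depend on the transmitted codeword X s. -/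

import Mathlib

open Matrix Finset MeasureTheory ProbabilityTheory

/-- A permutation matrix: entries lie in `{0, 1}` and every row sum and column sum is `1`. -/
def IsPermMatrix {n : ℕ} (X : Matrix (Fin n) (Fin n) ℝ) : Prop :=
  (∀ i j, X i j = 0 ∨ X i j = 1) ∧ (∀ i, ∑ j, X i j = 1) ∧ (∀ j, ∑ i, X i j = 1)

/-- The Gaussian Q-function: the tail of the standard normal distribution. -/
noncomputable def Qfun (x : ℝ) : ℝ :=
  ∫ t in Set.Ioi x, (Real.sqrt (2 * Real.pi))⁻¹ * Real.exp (-t ^ 2 / 2)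

lemma IsPermMatrix.exists_perm {n : ℕ} {X : Matrix (Fin n) (Fin n) ℝ} (hX : IsPermMatrix X) :
    ∃ p : Equiv.Perm (Fin n), X = p.permMatrix ℝ := by
  obtain ⟨h01, hrow, hcol⟩ := hX
  have hnn : ∀ i j, 0 ≤ X i j := fun i j => by rcases h01 i j with h | h <;> simp [h]
  have hex : ∀ i, ∃ j, X i j = 1 := by
    intro i
    by_contra! h
    have h0 : ∀ j, X i j = 0 := fun j => (h01 i j).resolve_right (h j)
    simpa [h0] using hrow i
  choose f hf using hex
  have hinj : Function.Injective f := by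
    intro a b hab
    by_contra hne
    have hle := Finset.sum_le_sum_of_subset_of_nonneg (Finset.subset_univ {a, b})
      (fun i _ _ => hnn i (f a))
    rw [Finset.sum_pair hne, hcol, hf a, hab, hf b] at hle
    norm_num at hle
  have huniq : ∀ i j, j ≠ f i → X i j = 0 := by
    intro i j hne
    refine (h01 i j).resolve_right fun h1 => ?_
    have hle := Finset.sum_le_sum_of_subset_of_nonneg (Finset.subset_univ {j, f i})
      (fun k _ _ => hnn i k)
    rw [Finset.sum_pair hne, hrow, hf i, h1] at hle
    norm_num at hle
  refine ⟨Equiv.ofBijective f (Finite.injective_iff_bijective.mp hinj), ?_⟩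
  ext i j
  by_cases h : j = f i
  · subst h
    simp [Equiv.Perm.permMatrix, PEquiv.toMatrix_apply, hf]
  · simp [Equiv.Perm.permMatrix, PEquiv.toMatrix_apply, huniq i j h, Ne.symm h]

/-- A linear functional of a vector with i.i.d. centred Gaussian coordinates is Gaussian. -/
lemma map_dotProduct_pi_gaussianReal {ι : Type*} [Fintype ι] (v : NNReal) (d : ι → ℝ) :
    (Measure.pi fun _ : ι => gaussianReal 0 v).map (fun z => z ⬝ᵥ d)
      = gaussianReal 0 (v * ∑ i, ‖d i‖₊ ^ 2) := by
  have hmeas : Measurable fun z : ι → ℝ => z ⬝ᵥ d := by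
    unfold dotProduct
    fun_prop
  have : IsProbabilityMeasure
      ((Measure.pi fun _ : ι => gaussianReal 0 v).map (fun z => z ⬝ᵥ d)) :=
    Measure.isProbabilityMeasure_map hmeas.aemeasurable
  refine Measure.ext_of_charFun (funext fun t => ?_)
  rw [charFun_apply_real, integral_map hmeas.aemeasurable (by fun_prop), charFun_gaussianReal]
  have hprod : ∀ z : ι → ℝ, Complex.exp (t * ((z ⬝ᵥ d : ℝ) : ℂ) * Complex.I)
      = ∏ i, Complex.exp (((t * d i : ℝ) : ℂ) * (z i : ℂ) * Complex.I) := by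
    intro z
    rw [← Complex.exp_sum]
    congr 1
    simp only [dotProduct, Complex.ofReal_sum, Complex.ofReal_mul, Finset.mul_sum, Finset.sum_mul]
    exact Finset.sum_congr rfl fun i _ => by ring
  simp_rw [hprod]
  rw [integral_fintype_prod_eq_prod
    (f := fun i (x : ℝ) => Complex.exp (((t * d i : ℝ) : ℂ) * (x : ℂ) * Complex.I))]
  simp_rw [← charFun_apply_real, charFun_gaussianReal]
  rw [← Complex.exp_sum]
  congr 1
  have hsq : ∀ i, (((‖d i‖₊ ^ 2 : NNReal) : ℝ) : ℂ) = (d i : ℂ) ^ 2 := fun i => by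
    rw [← Complex.ofReal_pow]
    simp
  simp only [NNReal.coe_mul, NNReal.coe_sum, Complex.ofReal_mul, Complex.ofReal_sum, hsq,
    Complex.ofReal_zero, mul_zero, zero_mul, zero_sub, Finset.sum_neg_distrib, Finset.mul_sum,
    Finset.sum_mul, Finset.sum_div]
  exact congrArg _ (Finset.sum_congr rfl fun i _ => by ring)

lemma gaussianReal_Ici_eq_Qfun (a : ℝ) :
    gaussianReal 0 1 (Set.Ici a) = ENNReal.ofReal (Qfun a) := by
  rw [gaussianReal_apply_eq_integral 0 one_ne_zero, integral_Ici_eq_integral_Ioi]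
  simp [Qfun, gaussianPDFReal]

/-- The pairwise error probability between signals at difference `d ≠ 0`. -/
lemma pi_gaussianReal_halfspace {ι : Type*} [Fintype ι] {σ : ℝ} (hσ : 0 < σ)
    {v : NNReal} (hv : (v : ℝ) = σ ^ 2) {d : ι → ℝ} (hd : d ≠ 0) :
    (Measure.pi fun _ : ι => gaussianReal 0 v)
      {z | (∑ i, d i ^ 2) / 2 ≤ z ⬝ᵥ d}
    = ENNReal.ofReal (Qfun (Real.sqrt (∑ i, d i ^ 2) / (2 * σ))) := by
  have hpos : 0 < ∑ i, d i ^ 2 := by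
    obtain ⟨i, hi⟩ := Function.ne_iff.mp hd
    exact Finset.sum_pos' (fun i _ => sq_nonneg _) ⟨i, Finset.mem_univ i, sq_pos_iff.mpr hi⟩
  set r := Real.sqrt (∑ i, d i ^ 2)
  have hrpos : 0 < r := Real.sqrt_pos.mpr hpos
  have hrsq : r ^ 2 = ∑ i, d i ^ 2 := Real.sq_sqrt hpos.le
  have hmeas : Measurable fun z : ι → ℝ => z ⬝ᵥ d := by
    unfold dotProduct
    fun_prop
  have hlaw := map_dotProduct_pi_gaussianReal v d
  have hscale : (gaussianReal 0 1).map ((σ * r) * ·)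
      = gaussianReal 0 (v * ∑ i, ‖d i‖₊ ^ 2) := by
    rw [gaussianReal_map_const_mul]
    congr 1
    · simp
    · ext
      simp [mul_pow, hrsq, hv]
  rw [← gaussianReal_Ici_eq_Qfun, ← hrsq]
  calc _ = (Measure.pi fun _ : ι => gaussianReal 0 v).map
          (fun z => z ⬝ᵥ d) (Set.Ici (r ^ 2 / 2)) := by
        rw [Measure.map_apply hmeas measurableSet_Ici]
        rfl
    _ = gaussianReal 0 1 (((σ * r) * ·) ⁻¹' Set.Ici (r ^ 2 / 2)) := by
        rw [hlaw, ← hscale, Measure.map_apply (by fun_prop) measurableSet_Ici]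
    _ = _ := by
        congr 1
        ext x
        simp only [Set.mem_preimage, Set.mem_Ici]
        rw [div_le_iff₀ (by positivity), div_le_iff₀ (by positivity)]
        constructor
        · intro h
          refine le_of_mul_le_mul_right ?_ hrpos
          linarith
        · intro h
          nlinarith [mul_le_mul_of_nonneg_right h hrpos.le]

/-- Codeword-independent ML union bound: for a group `G` of permutation matrices, an
initial vector `s` with pairwise distinct entries and transmitted codeword `X s` with
`X ∈ G`, the block error probability under i.i.d. Gaussian noise is at most
`Σ_{X̃ ∈ G, X̃ ≠ I} Q(‖X̃ s − s‖ / (2σ))`, a bound independent of `X`. -/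
theorem stmt19 (n : ℕ) (hn : 1 ≤ n)
    (G : Finset (Matrix (Fin n) (Fin n) ℝ))
    (hGperm : ∀ X ∈ G, IsPermMatrix X)
    (hGone : (1 : Matrix (Fin n) (Fin n) ℝ) ∈ G)
    (hGmul : ∀ X ∈ G, ∀ Y ∈ G, X * Y ∈ G)
    (hGinv : ∀ X ∈ G, Xᵀ ∈ G)
    (s : Fin n → ℝ) (hs : Function.Injective s)
    (σ : ℝ) (hσ : 0 < σ)
    (X : Matrix (Fin n) (Fin n) ℝ) (hXG : X ∈ G) :
    (Measure.pi fun _ : Fin n => gaussianReal 0 ⟨σ ^ 2, sq_nonneg σ⟩)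
      {z : Fin n → ℝ | ∃ Xt ∈ G, Xt ≠ X ∧
        (X.mulVec s + z) ⬝ᵥ Xt.mulVec s ≥ (X.mulVec s + z) ⬝ᵥ X.mulVec s}
    ≤ ∑ Xt ∈ G.erase 1, ENNReal.ofReal (Qfun
        (Real.sqrt (∑ i, (Xt.mulVec s i - s i) ^ 2) / (2 * σ))) := by
  have hunion : {z : Fin n → ℝ | ∃ Xt ∈ G, Xt ≠ X ∧
        (X.mulVec s + z) ⬝ᵥ Xt.mulVec s ≥ (X.mulVec s + z) ⬝ᵥ X.mulVec s}
      = ⋃ Xt ∈ G.erase X,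
        {z | (X.mulVec s + z) ⬝ᵥ Xt.mulVec s ≥ (X.mulVec s + z) ⬝ᵥ X.mulVec s} := by
    ext z
    simp only [Set.mem_ofPred_eq, Set.mem_iUnion, Finset.mem_erase, exists_prop]
    exact exists_congr fun Y => by tauto
  rw [hunion]
  refine (measure_biUnion_finset_le _ _).trans ?_
  obtain ⟨p, hp⟩ := (hGperm X hXG).exists_perm
  have hXXt : X * Xᵀ = 1 := by
    rw [hp, Matrix.transpose_permMatrix, ← Matrix.permMatrix_mul]
    simp
  have hXtX : Xᵀ * X = 1 := mul_eq_one_comm.mp hXXt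
  refine le_of_eq (Finset.sum_bij' (fun Y _ => Xᵀ * Y) (fun Y _ => X * Y) ?_ ?_ ?_ ?_ ?_)
  · intro Y hY
    rw [Finset.mem_erase] at hY ⊢
    refine ⟨fun h => hY.1 ?_, hGmul _ (hGinv X hXG) _ hY.2⟩
    rw [← one_mul Y, ← hXXt, mul_assoc, h, mul_one]
  · intro Y hY
    rw [Finset.mem_erase] at hY ⊢
    refine ⟨fun h => hY.1 ?_, hGmul _ hXG _ hY.2⟩
    rw [← one_mul Y, ← hXtX, mul_assoc, h]
  · intro Y _
    rw [← mul_assoc, hXXt, one_mul]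
  · intro Y _
    rw [← mul_assoc, hXtX, one_mul]
  · intro Y hY
    rw [Finset.mem_erase] at hY
    obtain ⟨q, hq⟩ := (hGperm Y hY.2).exists_perm
    have hXs : X.mulVec s = s ∘ p := by rw [hp, Matrix.permMatrix_mulVec]
    have hYs : Y.mulVec s = s ∘ q := by rw [hq, Matrix.permMatrix_mulVec]
    have hdist : ∑ i, ((Xᵀ * Y).mulVec s i - s i) ^ 2 = ∑ i, (s (q i) - s (p i)) ^ 2 := by
      rw [← Matrix.mulVec_mulVec, hYs, hp, Matrix.transpose_permMatrix, Matrix.permMatrix_mulVec,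
        ← Equiv.sum_comp p]
      simp
    have hd : (fun i => s (q i) - s (p i)) ≠ 0 := by
      intro h
      refine hY.1 ?_
      rw [hp, hq, Equiv.ext fun i => hs (sub_eq_zero.mp (congrFun h i))]
    rw [hdist, ← pi_gaussianReal_halfspace hσ (v := .mk (σ ^ 2) (sq_nonneg σ)) rfl hd]
    congr 1
    ext z
    have hnorm : ∑ i, s (q i) ^ 2 = ∑ i, s (p i) ^ 2 := by
      rw [Equiv.sum_comp q (fun i => s i ^ 2), Equiv.sum_comp p (fun i => s i ^ 2)]
    have hkey : (s ∘ p + z) ⬝ᵥ (s ∘ q) - (s ∘ p + z) ⬝ᵥ (s ∘ p)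
        = z ⬝ᵥ (fun i => s (q i) - s (p i)) - (∑ i, (s (q i) - s (p i)) ^ 2) / 2 := by
      have hexp : ∑ i, (s (q i) - s (p i)) ^ 2
          = 2 * ∑ i, s (p i) ^ 2 - 2 * ∑ i, s (p i) * s (q i) := by
        have : ∀ i, (s (q i) - s (p i)) ^ 2
            = s (q i) ^ 2 + s (p i) ^ 2 - 2 * (s (p i) * s (q i)) := fun i => by ring
        simp_rw [this]
        rw [Finset.sum_sub_distrib, Finset.sum_add_distrib, hnorm, ← Finset.mul_sum]
        ring
      rw [hexp]
      simp only [dotProduct, Pi.add_apply, Function.comp_apply, add_mul, mul_sub,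
        Finset.sum_add_distrib, Finset.sum_sub_distrib, pow_two]
      ring
    simp only [Set.mem_ofPred_eq, hXs, hYs, ge_iff_le]
    rw [← sub_nonneg, hkey, sub_nonneg]
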